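/- Let c>0, 0<κ<1, 0<μ≤1 and 0<c'<c. Then there exists C₁>0, independent of μ, such that for every l∈ℕ and every ξ∈ℝ: |d^{l}/dξ^{l}( e^{-c⟨ξ⟩_μ^{κ}} )| ≤ C₁^{l+1}·l^{l}·⟨ξ⟩_μ^{-l}·e^{-c'⟨ξ⟩_μ^{κ}} (with the convention 0⁰=1). -/

import Mathlib

/-- `⟨ξ⟩_μ = (μ⁻² + ξ²)^(1/2)` -/
noncomputable def br (μ ξ : ℝ) : ℝ := Real.sqrt (μ⁻¹ ^ 2 + ξ ^ 2)

theorem aux_re (r κ : ℝ) (hr : r < 1) : ∃ δ : ℝ, 0 < δ ∧ ∀ u : ℂ, ‖u‖ < δ →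
    (1 + u) ∈ Complex.slitPlane ∧ r < ((1 + u) ^ ((κ / 2 : ℝ) : ℂ)).re := by
  have h1 : ContinuousAt (fun u : ℂ => ((1 + u) ^ ((κ / 2 : ℝ) : ℂ)).re) 0 := by
    apply Complex.continuous_re.continuousAt.comp
    apply ContinuousAt.cpow (by fun_prop) (by fun_prop)
    simp
  have h2 : ∀ᶠ u : ℂ in nhds 0, r < ((1 + u) ^ ((κ / 2 : ℝ) : ℂ)).re := by
    apply h1.eventually (lt_mem_nhds _)
    simpa using hr
  have h3 : ∀ᶠ u : ℂ in nhds 0, (1 + u) ∈ Complex.slitPlane := by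
    have : ContinuousAt (fun u : ℂ => 1 + u) 0 := by fun_prop
    apply this.eventually (Complex.isOpen_slitPlane.mem_nhds _)
    simp
  obtain ⟨δ, hδ, h⟩ := Metric.eventually_nhds_iff.1 (h3.and h2)
  exact ⟨δ, hδ, fun u hu => h (by simpa using hu)⟩

theorem aux_cpow (B κ : ℝ) (hB : 0 < B) (v : ℂ) (hv : v ≠ 0) :
    (((B ^ 2 : ℝ) : ℂ) * v) ^ ((κ / 2 : ℝ) : ℂ) = ((B ^ κ : ℝ) : ℂ) * v ^ ((κ / 2 : ℝ) : ℂ) := by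
  have hB2 : 0 < B ^ 2 := by positivity
  have h0 : ((B ^ 2 : ℝ) : ℂ) ≠ 0 := by exact_mod_cast hB2.ne'
  rw [Complex.cpow_def_of_ne_zero (mul_ne_zero h0 hv), Complex.log_ofReal_mul hB2 hv, add_mul,
    Complex.exp_add, ← Complex.cpow_def_of_ne_zero hv, Real.rpow_def_of_pos hB]
  congr 1
  rw [Real.log_pow]
  push_cast
  congr 1
  ring

/-- complex extension -/
noncomputable def Fext (c κ μ : ℝ) (z : ℂ) : ℂ :=
  Complex.exp (-((c : ℂ) * (((μ⁻¹ ^ 2 : ℝ) : ℂ) + z ^ 2) ^ ((κ / 2 : ℝ) : ℂ)))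

theorem Fext_analytic (c κ μ : ℝ) (z : ℂ)
    (hz : ((μ⁻¹ ^ 2 : ℝ) : ℂ) + z ^ 2 ∈ Complex.slitPlane) : AnalyticAt ℂ (Fext c κ μ) z := by
  unfold Fext
  have h : AnalyticAt ℂ (fun z : ℂ => ((μ⁻¹ ^ 2 : ℝ) : ℂ) + z ^ 2) z := by fun_prop
  exact (analyticAt_const.mul (h.cpow analyticAt_const hz)).neg.cexp

theorem br_pos (μ ξ : ℝ) (hμ : 0 < μ) : 0 < br μ ξ := by
  unfold br; positivity

theorem br_sq (μ ξ : ℝ) : br μ ξ ^ 2 = μ⁻¹ ^ 2 + ξ ^ 2 := by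
  unfold br; exact Real.sq_sqrt (by positivity)

theorem Fext_re (c κ μ : ℝ) (hμ : 0 < μ) (ξ : ℝ) :
    (Fext c κ μ ξ).re = Real.exp (-(c * br μ ξ ^ κ)) := by
  have h := aux_cpow (br μ ξ) κ (br_pos μ ξ hμ) 1 one_ne_zero
  rw [br_sq] at h
  simp only [mul_one, Complex.one_cpow] at h
  have : ((μ⁻¹ ^ 2 : ℝ) : ℂ) + (ξ : ℂ) ^ 2 = ((μ⁻¹ ^ 2 + ξ ^ 2 : ℝ) : ℂ) := by push_cast; ring
  unfold Fext
  rw [this, h]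
  rw [← Complex.exp_ofReal_re]
  push_cast
  rfl

theorem Fext_iter (c κ μ : ℝ) (hμ : 0 < μ) (l : ℕ) :
    iteratedDeriv l (fun ξ' => Real.exp (-(c * br μ ξ' ^ κ))) =
      fun ξ : ℝ => (iteratedDeriv l (Fext c κ μ) ξ).re := by
  induction l with
  | zero => funext ξ; simp [Fext_re c κ μ hμ]
  | succ n ih =>
    rw [iteratedDeriv_succ, ih]
    funext ξ
    have ha : AnalyticAt ℂ (Fext c κ μ) ξ := by
      apply Fext_analytic
      have : ((μ⁻¹ ^ 2 : ℝ) : ℂ) + (ξ : ℂ) ^ 2 = ((μ⁻¹ ^ 2 + ξ ^ 2 : ℝ) : ℂ) := by push_cast; ring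
      rw [this, Complex.ofReal_mem_slitPlane]
      positivity
    have hd : DifferentiableAt ℂ (iteratedDeriv n (Fext c κ μ)) ξ := by
      rw [iteratedDeriv_eq_iterate]
      exact (ha.iterated_deriv n).differentiableAt
    rw [hd.hasDerivAt.real_of_complex.deriv, iteratedDeriv_succ]

theorem stmt17 (c κ c' : ℝ) (hc : 0 < c) (hκ0 : 0 < κ) (hκ1 : κ < 1)
    (hc'0 : 0 < c') (hc'c : c' < c) :
    ∃ C₁ : ℝ, 0 < C₁ ∧
      ∀ μ : ℝ, 0 < μ → μ ≤ 1 →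
        ∀ (l : ℕ) (ξ : ℝ),
          |iteratedDeriv l (fun ξ' => Real.exp (-(c * br μ ξ' ^ κ))) ξ| ≤
            C₁ ^ (l + 1) * (l : ℝ) ^ l * br μ ξ ^ (-(l : ℝ)) *
              Real.exp (-(c' * br μ ξ ^ κ)) := by
  obtain ⟨δ, hδ, H⟩ := aux_re (c' / c) κ ((div_lt_one hc).2 hc'c)
  obtain ⟨ε, hε, hε1, hεδ⟩ : ∃ ε : ℝ, 0 < ε ∧ ε ≤ 1 ∧ 4 * ε ≤ δ :=
    ⟨min 1 (δ / 4), by positivity, min_le_left _ _, by linarith [min_le_right 1 (δ / 4)]⟩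
  refine ⟨ε⁻¹, by positivity, fun μ hμ _ l ξ => ?_⟩
  have hB := br_pos μ ξ hμ
  have hB2 := br_sq μ ξ
  set B := br μ ξ with hBdef
  have hξB : |ξ| ≤ B := by
    refine abs_le_of_sq_le_sq ?_ hB.le
    have : 0 < μ⁻¹ ^ 2 := by positivity
    linarith
  have key : ∀ z ∈ Metric.closedBall (ξ : ℂ) (ε * B), ∃ u : ℂ, ‖u‖ < δ ∧
      ((μ⁻¹ ^ 2 : ℝ) : ℂ) + z ^ 2 = ((B ^ 2 : ℝ) : ℂ) * (1 + u) := by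
    intro z hz
    have hz' : ‖z - ξ‖ ≤ ε * B := by simpa [dist_eq_norm] using hz
    have hBne : (B : ℂ) ≠ 0 := by exact_mod_cast hB.ne'
    refine ⟨(2 * ξ * (z - ξ) + (z - ξ) ^ 2) / ((B ^ 2 : ℝ) : ℂ), ?_, ?_⟩
    · rw [norm_div, Complex.norm_real, Real.norm_of_nonneg (by positivity), div_lt_iff₀ (by positivity)]
      calc _ ≤ 2 * |ξ| * ‖z - ξ‖ + ‖z - ξ‖ ^ 2 := by
            refine (norm_add_le _ _).trans ?_
            simp
        _ ≤ 2 * B * (ε * B) + (ε * B) ^ 2 := by gcongr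
        _ = (2 * ε + ε * ε) * B ^ 2 := by ring
        _ < δ * B ^ 2 := by
            gcongr
            nlinarith
    · have : ((μ⁻¹ ^ 2 : ℝ) : ℂ) = (B : ℂ) ^ 2 - (ξ : ℂ) ^ 2 := by
        rw [eq_sub_iff_add_eq]; exact_mod_cast hB2.symm
      rw [this]
      push_cast
      field_simp
      ring
  have hdiff : DiffContOnCl ℂ (Fext c κ μ) (Metric.ball (ξ : ℂ) (ε * B)) := by
    apply DifferentiableOn.diffContOnCl_ball (U := Metric.closedBall (ξ : ℂ) (ε * B)) _ subset_rfl
    intro z hz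
    obtain ⟨u, hu, h⟩ := key z hz
    apply (Fext_analytic c κ μ z _).differentiableAt.differentiableWithinAt
    rw [h]
    have := (H u hu).1
    have hp : 0 < B ^ 2 := by positivity
    rw [Complex.mem_slitPlane_iff] at this ⊢
    rw [Complex.re_ofReal_mul, Complex.im_ofReal_mul]
    rcases this with h | h
    · left; positivity
    · right; positivity
  have hbound : ∀ z ∈ Metric.sphere (ξ : ℂ) (ε * B),
      ‖Fext c κ μ z‖ ≤ Real.exp (-(c' * B ^ κ)) := by
    intro z hz
    obtain ⟨u, hu, h⟩ := key z (Metric.sphere_subset_closedBall hz)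
    have h2 := (H u hu)
    unfold Fext
    rw [Complex.norm_exp, h, aux_cpow B κ hB _ (Complex.slitPlane_ne_zero h2.1)]
    apply Real.exp_le_exp.2
    rw [Complex.neg_re, Complex.re_ofReal_mul, Complex.re_ofReal_mul]
    have h3 : c' ≤ c * ((1 + u) ^ ((κ / 2 : ℝ) : ℂ)).re := by
      have := h2.2.le
      rwa [div_le_iff₀' hc] at this
    have hp : 0 < B ^ κ := by positivity
    nlinarith
  have hC := Complex.norm_iteratedDeriv_le_of_forall_mem_sphere_norm_le l (by positivity) hdiff hbound
  rw [Fext_iter c κ μ hμ l]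
  refine (Complex.abs_re_le_norm _).trans (hC.trans ?_)
  have hfac : (l.factorial : ℝ) ≤ (l : ℝ) ^ l := by exact_mod_cast Nat.factorial_le_pow l
  have hpow : (ε⁻¹) ^ l ≤ (ε⁻¹) ^ (l + 1) :=
    pow_le_pow_right₀ ((one_le_inv₀ hε).2 hε1) (Nat.le_succ l)
  rw [Real.rpow_neg hB.le, Real.rpow_natCast]
  calc _ = ε⁻¹ ^ l * (l.factorial : ℝ) * (B ^ l)⁻¹ * Real.exp (-(c' * B ^ κ)) := by
        rw [mul_pow, inv_pow]; field_simp
    _ ≤ _ := by gcongr
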